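/- Let C be a bivariate extreme value copula with upper tail dependence coefficient λ ∈ [0,1], and let μ be the probability measure on [0,1]² with μ([0,u]×[0,v]) = C(u,v) for all u, v ∈ [0,1]. Then Kendall's coefficient τ = 4∫ C dμ − 1 satisfies τ ≤ λ. -/

import Mathlib

open MeasureTheory Filter Set Real

noncomputable section

/-- A bivariate copula: boundary conditions and the 2-increasing property. -/
def IsCopula (C : ℝ → ℝ → ℝ) : Prop :=
  (∀ u : ℝ, 0 ≤ u → u ≤ 1 → C u 0 = 0 ∧ C 0 u = 0 ∧ C u 1 = u ∧ C 1 u = u) ∧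
  (∀ u₁ u₂ v₁ v₂ : ℝ, 0 ≤ u₁ → u₁ ≤ u₂ → u₂ ≤ 1 → 0 ≤ v₁ → v₁ ≤ v₂ → v₂ ≤ 1 →
    0 ≤ C u₂ v₂ - C u₂ v₁ - C u₁ v₂ + C u₁ v₁)

/-- An extreme value copula: a copula satisfying the max-stability identity. -/
def IsExtremeValueCopula (C : ℝ → ℝ → ℝ) : Prop :=
  IsCopula C ∧ ∀ s : ℝ, 0 < s → ∀ u v : ℝ, 0 ≤ u → u ≤ 1 → 0 ≤ v → v ≤ 1 →
    C (u ^ s) (v ^ s) = C u v ^ s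

/-- `C` has upper tail dependence coefficient `lam`,
i.e. `lam = 2 - lim_{t → 1⁻} (1 - C t t)/(1 - t)`. -/
def HasUpperTailDep (C : ℝ → ℝ → ℝ) (lam : ℝ) : Prop :=
  Tendsto (fun t : ℝ => (1 - C t t) / (1 - t)) (nhdsWithin 1 (Set.Iio 1))
    (nhds (2 - lam))


/-- Probability measures on the plane agreeing on lower left quadrants are equal. -/
theorem measure_ext_Iic_prod_Iic {ρ ρ' : Measure (ℝ × ℝ)} [IsProbabilityMeasure ρ]
    [IsProbabilityMeasure ρ'] (h : ∀ a b : ℝ, ρ (Iic a ×ˢ Iic b) = ρ' (Iic a ×ˢ Iic b)) :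
    ρ = ρ' := by
  have hspan : IsCountablySpanning (range (Iic : ℝ → Set ℝ)) :=
    ⟨fun n : ℕ => Iic (n : ℝ), fun n => ⟨_, rfl⟩, iUnion_Iic_of_not_bddAbove_range (by
      rintro ⟨c, hc⟩
      obtain ⟨n, hn⟩ := exists_nat_gt c
      exact absurd (hc ⟨n, rfl⟩) (not_le.2 hn))⟩
  have hgen : MeasurableSpace.generateFrom (range (Iic : ℝ → Set ℝ)) = borel ℝ :=
    (borel_eq_generateFrom_Iic ℝ).symm
  have hb : (inferInstance : MeasurableSpace ℝ) = borel ℝ := BorelSpace.measurable_eq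
  refine ext_of_generate_finite _ (generateFrom_eq_prod (hgen.trans hb.symm)
    (hgen.trans hb.symm) hspan hspan).symm (isPiSystem_Iic.prod isPiSystem_Iic) ?_ (by simp)
  rintro _ ⟨_, ⟨a, rfl⟩, _, ⟨b, rfl⟩, rfl⟩
  exact h a b

/-- Probability measures on the unit square are determined by their distribution function. -/
theorem measure_ext_Icc_prod_Icc {ρ ρ' : Measure (ℝ × ℝ)} [IsProbabilityMeasure ρ]
    [IsProbabilityMeasure ρ'] (h1 : ρ (Icc 0 1 ×ˢ Icc 0 1) = 1)
    (h : ∀ u ∈ Icc (0 : ℝ) 1, ∀ v ∈ Icc (0 : ℝ) 1,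
      ρ (Icc 0 u ×ˢ Icc 0 v) = ρ' (Icc 0 u ×ˢ Icc 0 v)) :
    ρ = ρ' := by
  have key : ∀ (κ : Measure (ℝ × ℝ)) [IsProbabilityMeasure κ],
      κ (Icc 0 1 ×ˢ Icc 0 1) = 1 → ∀ a b : ℝ,
      κ (Iic a ×ˢ Iic b) = κ (Icc 0 (min a 1) ×ˢ Icc 0 (min b 1)) := by
    intro κ _ hκ a b
    have hae : ∀ᵐ z ∂κ, z ∈ Icc (0 : ℝ) 1 ×ˢ Icc (0 : ℝ) 1 :=
      (prob_compl_eq_zero_iff (measurableSet_Icc.prod measurableSet_Icc)).2 hκ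
    refine measure_congr ?_
    filter_upwards [hae] with z hz
    simp only [mem_prod, mem_Icc] at hz
    apply propext
    change (z ∈ Iic a ×ˢ Iic b) ↔ (z ∈ Icc 0 (min a 1) ×ˢ Icc 0 (min b 1))
    simp only [mem_prod, mem_Icc, mem_Iic, le_min_iff]
    tauto
  have h1' : ρ' (Icc 0 1 ×ˢ Icc 0 1) = 1 := by rw [← h 1 (by simp) 1 (by simp), h1]
  refine measure_ext_Iic_prod_Iic fun a b => ?_
  rw [key ρ h1, key ρ' h1']
  rcases lt_or_ge a 0 with ha | ha
  · rw [Icc_eq_empty (a := (0 : ℝ)) (b := min a 1) (by simp [ha])]; simp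
  rcases lt_or_ge b 0 with hb | hb
  · rw [Icc_eq_empty (a := (0 : ℝ)) (b := min b 1) (by simp [hb])]; simp
  exact h _ ⟨by simp [ha], by simp⟩ _ ⟨by simp [hb], by simp⟩

/-- A probability measure on the line whose distribution function is the identity of `[0, 1]`
has no atoms. -/
theorem nullSingletonClass_of_measure_Icc {ρ : Measure ℝ} [IsProbabilityMeasure ρ]
    (h : ∀ u ∈ Icc (0 : ℝ) 1, ρ (Icc 0 u) = ENNReal.ofReal u) : NullSingletonClass ρ := by
  have h1 : ρ (Icc 0 1) = 1 := by simpa using h 1 (by simp)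
  have hae : ∀ᵐ z ∂ρ, z ∈ Icc (0 : ℝ) 1 := (prob_compl_eq_zero_iff measurableSet_Icc).2 h1
  have : ρ = volume.restrict (Icc 0 1) := by
    refine Measure.ext_of_Iic _ _ fun a => ?_
    rw [Measure.restrict_apply measurableSet_Iic]
    have e1 : ρ (Iic a) = ρ (Icc 0 (min a 1)) := by
      refine measure_congr ?_
      filter_upwards [hae] with z hz
      apply propext
      change z ∈ Iic a ↔ z ∈ Icc 0 (min a 1)
      simp only [mem_Icc, mem_Iic, le_min_iff] at hz ⊢
      tauto
    have e2 : Iic a ∩ Icc (0 : ℝ) 1 = Icc 0 (min a 1) := by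
      ext z; simp only [mem_inter_iff, mem_Icc, mem_Iic, le_min_iff]; tauto
    rw [e1, e2]
    rcases lt_or_ge a 0 with ha | ha
    · rw [Icc_eq_empty (a := (0 : ℝ)) (b := min a 1) (by simp [ha])]; simp
    · rw [h _ ⟨by simp [ha], by simp⟩]; simp
  rw [this]
  infer_instance

section IndependentCopies

variable {ι : Type*} [Fintype ι] [DecidableEq ι]

omit [DecidableEq ι] in
theorem measurePreserving_pi_comp_perm {α : Type*} [MeasurableSpace α] (μ : Measure α)
    [IsProbabilityMeasure μ] (σ : Equiv.Perm ι) :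
    MeasurePreserving (fun (ω : ι → α) k => ω (σ k)) (Measure.pi fun _ => μ)
      (Measure.pi fun _ => μ) := by
  have hm : Measurable (fun (ω : ι → α) k => ω (σ k)) := by fun_prop
  refine ⟨hm, (Measure.pi_eq fun s hs => ?_).symm⟩
  rw [Measure.map_apply hm (MeasurableSet.univ_pi hs)]
  have : (fun (ω : ι → α) k => ω (σ k)) ⁻¹' (univ.pi s) = univ.pi fun k => s (σ.symm k) := by
    ext ω
    simp only [mem_preimage, mem_univ_pi]
    exact ⟨fun h k => by simpa using h (σ.symm k), fun h k => by simpa using h (σ k)⟩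
  rw [this, Measure.pi_pi]
  exact Equiv.prod_comp σ.symm fun k => μ (s k)

theorem measurePreserving_pi_split {α : Type*} [MeasurableSpace α] (μ : Measure α)
    [IsProbabilityMeasure μ] (i : ι) :
    MeasurePreserving (fun ω : ι → α => (ω i, fun k : {k // k ≠ i} => ω k))
      (Measure.pi fun _ => μ) (μ.prod (Measure.pi fun _ => μ)) := by
  have h := measurePreserving_piEquivPiSubtypeProd (fun _ : ι => μ) (fun k => k = i)
  rw [Subsingleton.elim (Subtype.fintype fun k => k = i) (Fintype.subtypeEq i)] at h
  have h' := ((measurePreserving_eval (fun _ : {k // k = i} => μ) ⟨i, rfl⟩).prod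
    (MeasurePreserving.id (Measure.pi fun _ : {k // ¬ k = i} => μ))).comp h
  exact h'

/-- The event that the first coordinates are maximal at `i`, and the second ones at `j`. -/
def maxAt (i j : ι) : Set (ι → ℝ × ℝ) :=
  {ω | (∀ k, (ω k).1 ≤ (ω i).1) ∧ ∀ k, (ω k).2 ≤ (ω j).2}

omit [DecidableEq ι] in
theorem measurableSet_maxAt (i j : ι) : MeasurableSet (maxAt i j) := by
  have h₁ : MeasurableSet {ω : ι → ℝ × ℝ | ∀ k, (ω k).1 ≤ (ω i).1} := by
    simp only [ofPred_forall]
    exact MeasurableSet.iInter fun k => measurableSet_le (by fun_prop) (by fun_prop)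
  have h₂ : MeasurableSet {ω : ι → ℝ × ℝ | ∀ k, (ω k).2 ≤ (ω j).2} := by
    simp only [ofPred_forall]
    exact MeasurableSet.iInter fun k => measurableSet_le (by fun_prop) (by fun_prop)
  exact h₁.inter h₂

omit [DecidableEq ι] in
theorem measure_maxAt_perm (μ : Measure (ℝ × ℝ)) [IsProbabilityMeasure μ] (σ : Equiv.Perm ι)
    (i j : ι) : (Measure.pi fun _ => μ) (maxAt (σ i) (σ j)) =
      (Measure.pi fun _ => μ) (maxAt i j) := by
  rw [← (measurePreserving_pi_comp_perm μ σ).measure_preimage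
    (measurableSet_maxAt i j).nullMeasurableSet]
  congr 1
  ext ω
  simp only [maxAt, mem_preimage, mem_ofPred_eq]
  exact and_congr (σ.surjective.forall (p := fun k => (ω k).1 ≤ (ω (σ i)).1))
    (σ.surjective.forall (p := fun k => (ω k).2 ≤ (ω (σ j)).2))

theorem measure_maxAt_self (μ : Measure (ℝ × ℝ)) [IsProbabilityMeasure μ] (i j : ι) :
    (Measure.pi fun _ => μ) (maxAt i i) = (Measure.pi fun _ => μ) (maxAt j j) := by
  simpa using measure_maxAt_perm μ (Equiv.swap j i) j j

theorem measure_maxAt_of_ne (μ : Measure (ℝ × ℝ)) [IsProbabilityMeasure μ] {i j i' j' : ι}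
    (h : i ≠ j) (h' : i' ≠ j') :
    (Measure.pi fun _ => μ) (maxAt i j) = (Measure.pi fun _ => μ) (maxAt i' j') := by
  rw [← measure_maxAt_perm μ (Equiv.swap (Equiv.swap i i' j) j' * Equiv.swap i i') i j]
  have hne : i' ≠ Equiv.swap i i' j := fun e => h ((Equiv.swap i i').injective (by simpa using e))
  simp [Equiv.swap_apply_of_ne_of_ne hne h']

/-- Almost surely the coordinates of independent copies have no ties. -/
theorem measure_pi_tie_eq_zero {α : Type*} [MeasurableSpace α] (μ : Measure α)
    [IsProbabilityMeasure μ] {f : α → ℝ} (hf : Measurable f) (h0 : ∀ t, μ {z | f z = t} = 0)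
    {i j : ι} (hij : i ≠ j) :
    (Measure.pi fun _ => μ) {ω : ι → α | f (ω i) = f (ω j)} = 0 := by
  have hms : MeasurableSet {p : α × ({k // k ≠ i} → α) | f p.1 = f (p.2 ⟨j, hij.symm⟩)} :=
    measurableSet_eq_fun (by fun_prop) (by fun_prop)
  have := (measurePreserving_pi_split μ i).measure_preimage hms.nullMeasurableSet
  rw [Measure.prod_apply_symm hms] at this
  refine this.trans ?_
  simp [preimage, h0]

theorem sum_measure_maxAt_le (μ : Measure (ℝ × ℝ)) [IsProbabilityMeasure μ]
    (h₁ : ∀ t, μ {z | z.1 = t} = 0) (h₂ : ∀ t, μ {z | z.2 = t} = 0) :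
    ∑ p : ι × ι, (Measure.pi fun _ => μ) (maxAt p.1 p.2) ≤ 1 := by
  refine (sum_measure_le_measure_univ
    (fun p _ => (measurableSet_maxAt p.1 p.2).nullMeasurableSet) ?_).trans (by simp)
  rintro ⟨i, j⟩ - ⟨i', j'⟩ - hne
  rcases eq_or_ne i i' with rfl | hi
  · have hj : j ≠ j' := fun e => hne (by rw [e])
    exact measure_mono_null (fun ω hω => le_antisymm (hω.2.2 j) (hω.1.2 j'))
      (measure_pi_tie_eq_zero μ measurable_snd h₂ hj)
  · exact measure_mono_null (fun ω hω => le_antisymm (hω.2.1 i) (hω.1.1 i'))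
      (measure_pi_tie_eq_zero μ measurable_fst h₁ hi)

theorem measure_maxAt_self_eq_lintegral (μ : Measure (ℝ × ℝ)) [IsProbabilityMeasure μ] (i : ι) :
    (Measure.pi fun _ => μ) (maxAt i i) =
      ∫⁻ z, μ (Iic z) ^ (Fintype.card ι - 1) ∂μ := by
  have hms : MeasurableSet {p : (ℝ × ℝ) × ({k // k ≠ i} → ℝ × ℝ) | ∀ k, p.2 k ≤ p.1} := by
    simp only [ofPred_forall]
    exact MeasurableSet.iInter fun k => measurableSet_le (by fun_prop) (by fun_prop)
  have := (measurePreserving_pi_split μ i).measure_preimage hms.nullMeasurableSet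
  rw [Measure.prod_apply hms] at this
  calc _ = _ := by
        congr 1
        ext ω
        simp only [maxAt, mem_preimage, mem_ofPred_eq, Prod.le_def, Subtype.forall]
        refine ⟨fun h k _ => ⟨h.1 k, h.2 k⟩, fun h => ⟨fun k => ?_, fun k => ?_⟩⟩
        · rcases eq_or_ne k i with rfl | hk
          exacts [le_rfl, (h k hk).1]
        · rcases eq_or_ne k i with rfl | hk
          exacts [le_rfl, (h k hk).2]
    _ = _ := this
    _ = _ := by
        refine lintegral_congr fun z => ?_
        have : Prod.mk z ⁻¹' {p : (ℝ × ℝ) × ({k // k ≠ i} → ℝ × ℝ) | ∀ k, p.2 k ≤ p.1} =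
            univ.pi fun _ => Iic z := by
          ext ω; simp [Pi.le_def]
        rw [this, Measure.pi_pi]
        simp [Fintype.card_subtype_compl]

end IndependentCopies

/-- The power of the coordinatewise maximum of a finite family of points of the plane whose
exponent is the size of the family. -/
def maxPow (ι : Type*) [Fintype ι] [Nonempty ι] (ω : ι → ℝ × ℝ) : ℝ × ℝ :=
  (Finset.univ.sup' Finset.univ_nonempty fun i => (ω i).1 ^ Fintype.card ι,
    Finset.univ.sup' Finset.univ_nonempty fun i => (ω i).2 ^ Fintype.card ι)

theorem measurable_maxPow (ι : Type*) [Fintype ι] [Nonempty ι] : Measurable (maxPow ι) := by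
  have h₁ : Measurable (Finset.univ.sup' Finset.univ_nonempty
      fun i (ω : ι → ℝ × ℝ) => (ω i).1 ^ Fintype.card ι) :=
    Finset.measurable_sup' _ fun i _ => by fun_prop
  have h₂ : Measurable (Finset.univ.sup' Finset.univ_nonempty
      fun i (ω : ι → ℝ × ℝ) => (ω i).2 ^ Fintype.card ι) :=
    Finset.measurable_sup' _ fun i _ => by fun_prop
  convert h₁.prodMk h₂ using 1
  ext ω <;> simp [maxPow]

theorem maxPow_mem_iff {ι : Type*} [Fintype ι] [Nonempty ι] {ω : ι → ℝ × ℝ}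
    (h₁ : ∀ i, 0 ≤ (ω i).1) (h₂ : ∀ i, 0 ≤ (ω i).2) {u v : ℝ} :
    maxPow ι ω ∈ Icc 0 u ×ˢ Icc 0 v ↔
      ∀ i, (ω i).1 ^ Fintype.card ι ≤ u ∧ (ω i).2 ^ Fintype.card ι ≤ v := by
  obtain ⟨i₀⟩ := ‹Nonempty ι›
  simp only [maxPow, mem_prod, mem_Icc, Finset.sup'_le_iff, Finset.le_sup'_iff,
    Finset.mem_univ, true_and, true_implies]
  exact ⟨fun h i => ⟨h.1.2 i, h.2.2 i⟩, fun h =>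
    ⟨⟨⟨i₀, pow_nonneg (h₁ _) _⟩, fun i => (h i).1⟩, ⟨i₀, pow_nonneg (h₂ _) _⟩, fun i => (h i).2⟩⟩

section Copula

variable {C : ℝ → ℝ → ℝ} {μ : Measure (ℝ × ℝ)} [IsProbabilityMeasure μ]

omit [IsProbabilityMeasure μ] in
theorem measure_unitSquare (hC : IsCopula C)
    (hμ : ∀ u v : ℝ, u ∈ Set.Icc (0:ℝ) 1 → v ∈ Set.Icc (0:ℝ) 1 →
      μ (Set.Icc 0 u ×ˢ Set.Icc 0 v) = ENNReal.ofReal (C u v)) :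
    μ (Icc 0 1 ×ˢ Icc 0 1) = 1 := by
  rw [hμ 1 1 (by simp) (by simp), (hC.1 1 (by simp) le_rfl).2.2.1, ENNReal.ofReal_one]

theorem ae_mem_unitSquare (hC : IsCopula C)
    (hμ : ∀ u v : ℝ, u ∈ Set.Icc (0:ℝ) 1 → v ∈ Set.Icc (0:ℝ) 1 →
      μ (Set.Icc 0 u ×ˢ Set.Icc 0 v) = ENNReal.ofReal (C u v)) :
    ∀ᵐ z ∂μ, z ∈ Icc (0 : ℝ) 1 ×ˢ Icc (0 : ℝ) 1 :=
  (prob_compl_eq_zero_iff (measurableSet_Icc.prod measurableSet_Icc)).2 (measure_unitSquare hC hμ)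

theorem measure_fst_eq_zero (hC : IsCopula C)
    (hμ : ∀ u v : ℝ, u ∈ Set.Icc (0:ℝ) 1 → v ∈ Set.Icc (0:ℝ) 1 →
      μ (Set.Icc 0 u ×ˢ Set.Icc 0 v) = ENNReal.ofReal (C u v)) (t : ℝ) :
    μ {z | z.1 = t} = 0 := by
  have : IsProbabilityMeasure (μ.map Prod.fst) :=
    Measure.isProbabilityMeasure_map measurable_fst.aemeasurable
  have hn : NullSingletonClass (μ.map Prod.fst) := by
    refine nullSingletonClass_of_measure_Icc fun u hu => ?_
    have hmargin := hμ u 1 hu (by simp)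
    rw [(hC.1 u hu.1 hu.2).2.2.1] at hmargin
    rw [Measure.map_apply measurable_fst measurableSet_Icc, ← hmargin]
    refine measure_congr ?_
    filter_upwards [ae_mem_unitSquare hC hμ] with z hz
    apply propext
    change z.1 ∈ Icc 0 u ↔ z ∈ Icc 0 u ×ˢ Icc 0 1
    exact ⟨fun h => ⟨h, hz.2⟩, fun h => h.1⟩
  have := measure_singleton (μ := μ.map Prod.fst) t
  rwa [Measure.map_apply measurable_fst (measurableSet_singleton t)] at this

theorem measure_snd_eq_zero (hC : IsCopula C)
    (hμ : ∀ u v : ℝ, u ∈ Set.Icc (0:ℝ) 1 → v ∈ Set.Icc (0:ℝ) 1 →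
      μ (Set.Icc 0 u ×ˢ Set.Icc 0 v) = ENNReal.ofReal (C u v)) (t : ℝ) :
    μ {z | z.2 = t} = 0 := by
  have : IsProbabilityMeasure (μ.map Prod.snd) :=
    Measure.isProbabilityMeasure_map measurable_snd.aemeasurable
  have hn : NullSingletonClass (μ.map Prod.snd) := by
    refine nullSingletonClass_of_measure_Icc fun u hu => ?_
    have hmargin := hμ 1 u (by simp) hu
    rw [(hC.1 u hu.1 hu.2).2.2.2] at hmargin
    rw [Measure.map_apply measurable_snd measurableSet_Icc, ← hmargin]
    refine measure_congr ?_
    filter_upwards [ae_mem_unitSquare hC hμ] with z hz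
    apply propext
    change z.2 ∈ Icc 0 u ↔ z ∈ Icc 0 1 ×ˢ Icc 0 u
    exact ⟨fun h => ⟨hz.1, h⟩, fun h => h.2⟩
  have := measure_singleton (μ := μ.map Prod.snd) t
  rwa [Measure.map_apply measurable_snd (measurableSet_singleton t)] at this

theorem measure_Iic_ae_eq (hC : IsCopula C)
    (hμ : ∀ u v : ℝ, u ∈ Set.Icc (0:ℝ) 1 → v ∈ Set.Icc (0:ℝ) 1 →
      μ (Set.Icc 0 u ×ˢ Set.Icc 0 v) = ENNReal.ofReal (C u v)) :
    ∀ᵐ z ∂μ, μ (Iic z) = ENNReal.ofReal (C z.1 z.2) := by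
  filter_upwards [ae_mem_unitSquare hC hμ] with z hz
  rw [← hμ _ _ hz.1 hz.2]
  refine measure_congr ?_
  filter_upwards [ae_mem_unitSquare hC hμ] with w hw
  apply propext
  change w ∈ Iic z ↔ w ∈ Icc 0 z.1 ×ˢ Icc 0 z.2
  exact ⟨fun h => ⟨⟨hw.1.1, h.1⟩, hw.2.1, h.2⟩, fun h => ⟨h.1.2, h.2.2⟩⟩

theorem IsCopula.nonneg (hC : IsCopula C) {u v : ℝ} (hu : u ∈ Icc (0 : ℝ) 1)
    (hv : v ∈ Icc (0 : ℝ) 1) : 0 ≤ C u v := by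
  have := hC.2 0 u 0 v le_rfl hu.1 hu.2 le_rfl hv.1 hv.2
  rw [(hC.1 u hu.1 hu.2).1, (hC.1 v hv.1 hv.2).2.1, (hC.1 0 le_rfl zero_le_one).1] at this
  linarith

theorem IsCopula.le_left (hC : IsCopula C) {u v : ℝ} (hu : u ∈ Icc (0 : ℝ) 1)
    (hv : v ∈ Icc (0 : ℝ) 1) : C u v ≤ u := by
  have := hC.2 0 u v 1 le_rfl hu.1 hu.2 hv.1 hv.2 le_rfl
  rw [(hC.1 u hu.1 hu.2).2.2.1, (hC.1 v hv.1 hv.2).2.1,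
    (hC.1 1 zero_le_one le_rfl).2.1] at this
  linarith

theorem IsCopula.le_right (hC : IsCopula C) {u v : ℝ} (hu : u ∈ Icc (0 : ℝ) 1)
    (hv : v ∈ Icc (0 : ℝ) 1) : C u v ≤ v := by
  have := hC.2 u 1 0 v hu.1 hu.2 le_rfl le_rfl hv.1 hv.2
  rw [(hC.1 v hv.1 hv.2).2.2.2, (hC.1 u hu.1 hu.2).1, (hC.1 1 zero_le_one le_rfl).1] at this
  linarith

/-- Max-stability: the suitably normalized coordinatewise maximum of independent copies has the
original law. -/
theorem map_maxPow_pi (ι : Type*) [Fintype ι] [Nonempty ι] (hC : IsExtremeValueCopula C)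
    (hμ : ∀ u v : ℝ, u ∈ Set.Icc (0:ℝ) 1 → v ∈ Set.Icc (0:ℝ) 1 →
      μ (Set.Icc 0 u ×ˢ Set.Icc 0 v) = ENNReal.ofReal (C u v)) :
    (Measure.pi fun _ : ι => μ).map (maxPow ι) = μ := by
  have : IsProbabilityMeasure ((Measure.pi fun _ : ι => μ).map (maxPow ι)) :=
    Measure.isProbabilityMeasure_map (measurable_maxPow ι).aemeasurable
  have hae : ∀ᵐ ω ∂(Measure.pi fun _ : ι => μ), ∀ i, ω i ∈ Icc (0 : ℝ) 1 ×ˢ Icc (0 : ℝ) 1 :=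
    ae_all_iff.2 fun i => (measurePreserving_eval (fun _ : ι => μ) i).quasiMeasurePreserving.ae
      (ae_mem_unitSquare hC.1 hμ)
  refine (measure_ext_Icc_prod_Icc (measure_unitSquare hC.1 hμ) fun u hu v hv => ?_).symm
  rw [Measure.map_apply (measurable_maxPow ι) (measurableSet_Icc.prod measurableSet_Icc)]
  set n := Fintype.card ι with hn
  have hn0 : n ≠ 0 := Fintype.card_ne_zero
  have hroot : ∀ {x : ℝ}, x ∈ Icc (0 : ℝ) 1 → x ^ (n⁻¹ : ℝ) ∈ Icc (0 : ℝ) 1 := fun hx =>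
    ⟨rpow_nonneg hx.1 _, rpow_le_one hx.1 hx.2 (by positivity)⟩
  have hpow : ∀ {x y : ℝ}, 0 ≤ x → 0 ≤ y → (x ^ n ≤ y ↔ x ≤ y ^ (n⁻¹ : ℝ)) := fun hx hy => by
    rw [Real.le_rpow_inv_iff_of_pos hx hy (by positivity), rpow_natCast]
  calc μ (Icc 0 u ×ˢ Icc 0 v) = ENNReal.ofReal (C u v) := hμ u v hu hv
    _ = μ (Icc 0 (u ^ (n⁻¹ : ℝ)) ×ˢ Icc 0 (v ^ (n⁻¹ : ℝ))) ^ n := by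
      rw [hμ _ _ (hroot hu) (hroot hv), hC.2 _ (by positivity) u v hu.1 hu.2 hv.1 hv.2,
        ← ENNReal.ofReal_pow (rpow_nonneg (hC.1.nonneg hu hv) _),
        Real.rpow_inv_natCast_pow (hC.1.nonneg hu hv) hn0]
    _ = (Measure.pi fun _ : ι => μ)
          (univ.pi fun _ => Icc 0 (u ^ (n⁻¹ : ℝ)) ×ˢ Icc 0 (v ^ (n⁻¹ : ℝ))) := by
      rw [Measure.pi_pi]; simp [hn]
    _ = _ := by
      refine measure_congr ?_
      filter_upwards [hae] with ω hω
      apply propext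
      change ω ∈ (univ.pi fun _ => Icc 0 (u ^ (n⁻¹ : ℝ)) ×ˢ Icc 0 (v ^ (n⁻¹ : ℝ))) ↔
        maxPow ι ω ∈ Icc 0 u ×ˢ Icc 0 v
      rw [maxPow_mem_iff (fun i => (hω i).1.1) fun i => (hω i).2.1, mem_univ_pi]
      refine forall_congr' fun i => ?_
      rw [hpow (hω i).1.1 hu.1, hpow (hω i).2.1 hv.1]
      exact ⟨fun h => ⟨h.1.2, h.2.2⟩, fun h => ⟨⟨(hω i).1.1, h.1⟩, (hω i).2.1, h.2⟩⟩

theorem lintegral_measure_Iic_le_sum_maxAt (ι : Type*) [Fintype ι] [DecidableEq ι] [Nonempty ι]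
    (hC : IsExtremeValueCopula C)
    (hμ : ∀ u v : ℝ, u ∈ Set.Icc (0:ℝ) 1 → v ∈ Set.Icc (0:ℝ) 1 →
      μ (Set.Icc 0 u ×ˢ Set.Icc 0 v) = ENNReal.ofReal (C u v)) :
    ∫⁻ z, μ (Iic z) ∂μ ≤
      ∑ p : ι × ι, (Measure.pi fun _ : ι ⊕ ι => μ) (maxAt (Sum.inl p.1) (Sum.inl p.2)) := by
  have hms : MeasurableSet {p : (ℝ × ℝ) × (ℝ × ℝ) | p.2 ≤ p.1} :=
    measurableSet_le measurable_snd measurable_fst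
  have hmp : MeasurePreserving (maxPow ι) (Measure.pi fun _ : ι => μ) μ :=
    ⟨measurable_maxPow ι, map_maxPow_pi ι hC hμ⟩
  have hmp2 := (hmp.prod hmp).comp (measurePreserving_sumPiEquivProdPi (fun _ : ι ⊕ ι => μ))
  have hae : ∀ᵐ ω ∂(Measure.pi fun _ : ι ⊕ ι => μ),
      ∀ i, ω i ∈ Icc (0 : ℝ) 1 ×ˢ Icc (0 : ℝ) 1 :=
    ae_all_iff.2 fun i => (measurePreserving_eval
      (fun _ : ι ⊕ ι => μ) i).quasiMeasurePreserving.ae (ae_mem_unitSquare hC.1 hμ)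
  calc ∫⁻ z, μ (Iic z) ∂μ = (μ.prod μ) {p | p.2 ≤ p.1} := (Measure.prod_apply hms).symm
    _ = _ := (hmp2.measure_preimage hms.nullMeasurableSet).symm
    _ ≤ (Measure.pi fun _ : ι ⊕ ι => μ)
          (⋃ p : ι × ι, maxAt (Sum.inl p.1) (Sum.inl p.2)) := by
      refine measure_mono_ae ?_
      filter_upwards [hae] with ω hω h
      change maxPow ι (fun i => ω (Sum.inr i)) ≤ maxPow ι (fun i => ω (Sum.inl i)) at h
      obtain ⟨i, -, hi⟩ := Finset.exists_mem_eq_sup' (Finset.univ_nonempty (α := ι))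
        fun i => (ω (Sum.inl i)).1 ^ Fintype.card ι
      obtain ⟨j, -, hj⟩ := Finset.exists_mem_eq_sup' (Finset.univ_nonempty (α := ι))
        fun i => (ω (Sum.inl i)).2 ^ Fintype.card ι
      have hn0 : Fintype.card ι ≠ 0 := Fintype.card_ne_zero
      have h₁ := h.1
      have h₂ := h.2
      simp only [maxPow] at h₁ h₂
      rw [hi] at h₁
      rw [hj] at h₂
      change ω ∈ ⋃ p : ι × ι, maxAt (Sum.inl p.1) (Sum.inl p.2)
      refine mem_iUnion.2 ⟨(i, j), fun k => ?_, fun k => ?_⟩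
      · refine (pow_le_pow_iff_left₀ (hω k).1.1 (hω _).1.1 hn0).1 ?_
        rcases k with k | k
        · exact hi ▸ Finset.le_sup' (fun i => (ω (Sum.inl i)).1 ^ Fintype.card ι)
            (Finset.mem_univ k)
        · exact (Finset.le_sup' (fun i => (ω (Sum.inr i)).1 ^ Fintype.card ι)
            (Finset.mem_univ k)).trans h₁
      · refine (pow_le_pow_iff_left₀ (hω k).2.1 (hω _).2.1 hn0).1 ?_
        rcases k with k | k
        · exact hj ▸ Finset.le_sup' (fun i => (ω (Sum.inl i)).2 ^ Fintype.card ι)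
            (Finset.mem_univ k)
        · exact (Finset.le_sup' (fun i => (ω (Sum.inr i)).2 ^ Fintype.card ι)
            (Finset.mem_univ k)).trans h₂
    _ ≤ _ := measure_iUnion_fintype_le _ _


/-- The diagonal section of an extreme value copula is a power function. -/
theorem IsExtremeValueCopula.diag_eq_rpow (hC : IsExtremeValueCopula C) {lam : ℝ}
    (hU : HasUpperTailDep C lam) {t : ℝ} (ht : t ∈ Ioc (0 : ℝ) 1) : C t t = t ^ (2 - lam) := by
  rcases eq_or_lt_of_le ht.2 with rfl | ht1
  · rw [one_rpow, (hC.1.1 1 zero_le_one le_rfl).2.2.1]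
  have ht0 : 0 < t := ht.1
  have htI : t ∈ Icc (0 : ℝ) 1 := ⟨ht0.le, ht1.le⟩
  have hc0 : 0 ≤ C t t := hC.1.nonneg htI htI
  have hcont : Tendsto (fun s : ℝ => t ^ s) (nhdsWithin 0 (Ioi 0)) (nhds 1) := by
    have : ContinuousAt (fun s : ℝ => t ^ s) 0 := continuousAt_const_rpow ht0.ne'
    simpa using this.tendsto.mono_left nhdsWithin_le_nhds
  have hlt : ∀ᶠ s in nhdsWithin (0 : ℝ) (Ioi 0), t ^ s < 1 := by
    filter_upwards [self_mem_nhdsWithin] with s hs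
    exact rpow_lt_one ht0.le ht1 hs
  have hratio : Tendsto (fun s : ℝ => (1 - C t t ^ s) / (1 - t ^ s)) (nhdsWithin 0 (Ioi 0))
      (nhds (2 - lam)) := by
    refine (hU.comp (tendsto_nhdsWithin_iff.2 ⟨hcont, hlt⟩)).congr' ?_
    filter_upwards [self_mem_nhdsWithin] with s hs
    simp only [Function.comp]
    rw [hC.2 s hs t t ht0.le ht1.le ht0.le ht1.le]
  have hcpos : 0 < C t t := by
    refine lt_of_le_of_ne hc0 fun h => ?_
    have h0 := (hcont.const_sub 1).mul hratio
    have h1 : Tendsto (fun s : ℝ => (1 - t ^ s) * ((1 - C t t ^ s) / (1 - t ^ s)))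
        (nhdsWithin 0 (Ioi 0)) (nhds 1) := by
      refine tendsto_const_nhds.congr' ?_
      filter_upwards [self_mem_nhdsWithin, hlt] with s hs hs1
      rw [mul_div_cancel₀ _ (by linarith), ← h, zero_rpow (ne_of_gt hs), sub_zero]
    have := tendsto_nhds_unique h0 h1
    simp at this
  have hslope : ∀ {a : ℝ}, 0 < a →
      Tendsto (fun s : ℝ => s⁻¹ * (a ^ s - 1)) (nhdsWithin 0 (Ioi 0)) (nhds (log a)) := by
    intro a ha
    have := ((hasStrictDerivAt_const_rpow ha 0).hasDerivAt).tendsto_slope_zero_right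
    simpa using this
  have hlog : log t ≠ 0 := (log_neg ht0 ht1).ne
  have hlim := (hslope hcpos).div (hslope ht0) hlog
  have heq : log (C t t) / log t = 2 - lam := by
    refine tendsto_nhds_unique (hlim.congr' ?_) hratio
    filter_upwards [self_mem_nhdsWithin, hlt] with s hs hs1
    have hs0 : s ≠ 0 := ne_of_gt hs
    simp only [Pi.div_apply]
    rw [mul_div_mul_left _ _ (inv_ne_zero hs0), ← neg_div_neg_eq]
    simp
  rw [div_eq_iff hlog] at heq
  rw [rpow_def_of_pos ht0, mul_comm, ← heq, exp_log hcpos]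

theorem measure_lt_min_le (hC : IsCopula C)
    (hμ : ∀ u v : ℝ, u ∈ Set.Icc (0:ℝ) 1 → v ∈ Set.Icc (0:ℝ) 1 →
      μ (Set.Icc 0 u ×ˢ Set.Icc 0 v) = ENNReal.ofReal (C u v)) {t : ℝ}
    (ht : t ∈ Icc (0 : ℝ) 1) :
    μ {z | t < min z.1 z.2} ≤ ENNReal.ofReal (1 - 2 * t + C t t) := by
  set A : Set (ℝ × ℝ) := Icc 0 t ×ˢ Icc 0 1
  set B : Set (ℝ × ℝ) := Icc 0 1 ×ˢ Icc 0 t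
  have hA : MeasurableSet A := measurableSet_Icc.prod measurableSet_Icc
  have hB : MeasurableSet B := measurableSet_Icc.prod measurableSet_Icc
  have hAB : A ∩ B = Icc 0 t ×ˢ Icc 0 t := by
    rw [prod_inter_prod, Icc_inter_Icc, Icc_inter_Icc]
    simp [ht.2]
  have h1 : μ.real A = t := by
    rw [measureReal_def, hμ t 1 ht (by simp), (hC.1 t ht.1 ht.2).2.2.1,
      ENNReal.toReal_ofReal ht.1]
  have h2 : μ.real B = t := by
    rw [measureReal_def, hμ 1 t (by simp) ht, (hC.1 t ht.1 ht.2).2.2.2,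
      ENNReal.toReal_ofReal ht.1]
  have h3 : μ.real (A ∩ B) = C t t := by
    rw [hAB, measureReal_def, hμ t t ht ht, ENNReal.toReal_ofReal (hC.nonneg ht ht)]
  have h4 := measureReal_union_add_inter (μ := μ) (s := A) hB
  calc μ {z | t < min z.1 z.2} ≤ μ (A ∪ B)ᶜ := by
        refine measure_mono fun z hz => ?_
        have hz' : t < z.1 ∧ t < z.2 := lt_min_iff.1 hz
        rintro (h | h)
        · exact absurd h.1.2 (not_le.2 hz'.1)
        · exact absurd h.2.2 (not_le.2 hz'.2)
    _ = ENNReal.ofReal (μ.real (A ∪ B)ᶜ) := (ofReal_measureReal).symm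
    _ = _ := by
        rw [probReal_compl_eq_one_sub (hA.union hB)]
        congr 1
        linarith

theorem lintegral_measure_Iic_pow_le (hC : IsExtremeValueCopula C) {lam : ℝ} (hlam : lam ≤ 1)
    (hU : HasUpperTailDep C lam)
    (hμ : ∀ u v : ℝ, u ∈ Set.Icc (0:ℝ) 1 → v ∈ Set.Icc (0:ℝ) 1 →
      μ (Set.Icc 0 u ×ˢ Set.Icc 0 v) = ENNReal.ofReal (C u v)) {K : ℕ} (hK : 0 < K) :
    ∫⁻ z, μ (Iic z) ^ K ∂μ ≤
      ENNReal.ofReal (1 - 2 * K / (K + 1) + K / (K + (2 - lam))) := by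
  have hK' : (0 : ℝ) < K := by exact_mod_cast hK
  have hae := ae_mem_unitSquare hC.1 hμ
  have hnn : ∀ t ∈ Ioc (0 : ℝ) 1, 0 ≤ 1 - 2 * t + C t t := fun t ht => by
    have := hC.1.2 t 1 t 1 ht.1.le ht.2 le_rfl ht.1.le ht.2 le_rfl
    rw [(hC.1.1 1 zero_le_one le_rfl).2.2.1, (hC.1.1 t ht.1.le ht.2).2.2.1,
      (hC.1.1 t ht.1.le ht.2).2.2.2] at this
    linarith
  have hi : ∀ {r : ℝ}, 0 < r → IntervalIntegrable (fun t : ℝ => t ^ (r - 1)) volume 0 1 :=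
    fun hr => intervalIntegral.intervalIntegrable_rpow' (by linarith)
  have hv : ∀ {r : ℝ}, 0 < r → ∫ t in (0 : ℝ)..1, t ^ (r - 1) = 1 / r := fun hr => by
    rw [integral_rpow (Or.inl (by linarith))]
    simp [hr.ne']
  let g : ℝ → ℝ := fun t =>
    t ^ ((K : ℝ) - 1) - 2 * t ^ ((K + 1 : ℝ) - 1) + t ^ ((K + (2 - lam) : ℝ) - 1)
  have hg : ∀ t ∈ Ioc (0 : ℝ) 1, g t = (1 - 2 * t + C t t) * t ^ ((K : ℝ) - 1) := by
    intro t ht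
    rw [hC.diag_eq_rpow hU ht]
    simp only [g]
    rw [show (K + 1 : ℝ) - 1 = 1 + (K - 1) by ring,
      show (K + (2 - lam) : ℝ) - 1 = (2 - lam) + (K - 1) by ring,
      rpow_add ht.1, rpow_add ht.1, rpow_one]
    ring
  have hint₁ := hi hK'
  have hint₂ := (hi (r := K + 1) (by positivity)).const_mul 2
  have hint₃ := hi (r := K + (2 - lam)) (by linarith)
  have hgint : IntervalIntegrable g volume 0 1 := (hint₁.sub hint₂).add hint₃
  have hgval : ∫ t in (0 : ℝ)..1, g t = 1 / K - 2 * (1 / (K + 1)) + 1 / (K + (2 - lam)) := by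
    simp only [g]
    rw [intervalIntegral.integral_add (hint₁.sub hint₂) hint₃,
      intervalIntegral.integral_sub hint₁ hint₂, intervalIntegral.integral_const_mul,
      hv hK', hv (by positivity), hv (by linarith)]
  calc ∫⁻ z, μ (Iic z) ^ K ∂μ
      ≤ ∫⁻ z, ENNReal.ofReal (min z.1 z.2 ^ (K : ℝ)) ∂μ := by
        refine lintegral_mono_ae ?_
        filter_upwards [measure_Iic_ae_eq hC.1 hμ, hae] with z hz hzI
        rw [hz, rpow_natCast, ENNReal.ofReal_pow (le_min hzI.1.1 hzI.2.1)]
        gcongr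
        exact le_min (hC.1.le_left hzI.1 hzI.2) (hC.1.le_right hzI.1 hzI.2)
    _ = ENNReal.ofReal K * ∫⁻ t in Ioi 0,
          μ {z | t < min z.1 z.2} * ENNReal.ofReal (t ^ ((K : ℝ) - 1)) := by
        refine lintegral_rpow_eq_lintegral_meas_lt_mul μ ?_ (by fun_prop) hK'
        filter_upwards [hae] with z hz
        exact le_min hz.1.1 hz.2.1
    _ ≤ ENNReal.ofReal K * ∫⁻ t in Ioc 0 1, ENNReal.ofReal (g t) := by
        refine mul_le_mul_right ?_ _
        rw [← Ioc_union_Ioi_eq_Ioi (zero_le_one (α := ℝ)),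
          lintegral_union measurableSet_Ioi Ioc_disjoint_Ioi_same]
        have hzero : ∫⁻ t in Ioi (1 : ℝ),
            μ {z | t < min z.1 z.2} * ENNReal.ofReal (t ^ ((K : ℝ) - 1)) = 0 := by
          refine setLIntegral_eq_zero measurableSet_Ioi fun t ht => ?_
          have : μ {z | t < min z.1 z.2} = 0 := by
            refine measure_eq_zero_iff_ae_notMem.2 ?_
            filter_upwards [hae] with z hzI hz
            exact absurd ((min_le_left _ _).trans hzI.1.2)
              (not_le.2 ((mem_Ioi.1 ht).trans hz))
          rw [this, zero_mul, Pi.zero_apply]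
        rw [hzero, add_zero]
        refine setLIntegral_mono' measurableSet_Ioc fun t ht => ?_
        rw [hg t ht, ENNReal.ofReal_mul (hnn t ht)]
        gcongr
        exact measure_lt_min_le hC.1 hμ ⟨ht.1.le, ht.2⟩
    _ = ENNReal.ofReal K * ENNReal.ofReal (∫ t in (0 : ℝ)..1, g t) := by
        rw [intervalIntegral.integral_of_le zero_le_one, ofReal_integral_eq_lintegral_ofReal
          ((intervalIntegrable_iff_integrableOn_Ioc_of_le zero_le_one).1 hgint)]
        filter_upwards [ae_restrict_mem measurableSet_Ioc] with t ht
        rw [hg t ht]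
        exact mul_nonneg (hnn t ht) (rpow_nonneg ht.1.le _)
    _ = _ := by
        rw [← ENNReal.ofReal_mul hK'.le, hgval]
        congr 1
        have h1 : (K + 1 : ℝ) ≠ 0 := by positivity
        have h2 : (K + (2 - lam) : ℝ) ≠ 0 := by linarith
        field_simp

theorem sum_ite_eq_card {ι : Type*} [Fintype ι] [DecidableEq ι] (h c : ℝ) :
    ∑ p : ι × ι, (if p.1 = p.2 then h else c) =
      Fintype.card ι * h + Fintype.card ι * (Fintype.card ι - 1) * c := by
  have : ∀ p : ι × ι, (if p.1 = p.2 then h else c) = c + if p.1 = p.2 then h - c else 0 := by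
    intro p; split_ifs <;> ring
  rw [Finset.sum_congr rfl fun p _ => this p, Finset.sum_add_distrib, Fintype.sum_prod_type,
    Fintype.sum_prod_type]
  simp
  ring

/-- Kendall's coefficient is at most the tail coefficient, up to an error that vanishes with the
number of independent copies used. -/
theorem four_mul_integral_sub_one_le_add (hC : IsExtremeValueCopula C) {lam : ℝ}
    (hlam : lam ∈ Icc (0 : ℝ) 1) (hU : HasUpperTailDep C lam)
    (hμ : ∀ u v : ℝ, u ∈ Set.Icc (0:ℝ) 1 → v ∈ Set.Icc (0:ℝ) 1 →
      μ (Set.Icc 0 u ×ˢ Set.Icc 0 v) = ENNReal.ofReal (C u v)) (k : ℕ) :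
    4 * (∫ p : ℝ × ℝ, C p.1 p.2 ∂μ) - 1 ≤ lam + 1 / (k + 1) := by
  let ι := Fin (k + 1)
  let Q : Measure (ι ⊕ ι → ℝ × ℝ) := Measure.pi fun _ => μ
  let h := Q.real (maxAt (Sum.inl 0) (Sum.inl 0))
  let c := Q.real (maxAt (Sum.inl 0) (Sum.inr 0))
  have hQ : ∀ i j : ι ⊕ ι, Q.real (maxAt i j) = if i = j then h else c := by
    intro i j
    split_ifs with hij
    · subst hij
      exact congrArg ENNReal.toReal (measure_maxAt_self μ _ _)
    · exact congrArg ENNReal.toReal (measure_maxAt_of_ne μ hij (by simp))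
  have hint : ∫ p : ℝ × ℝ, C p.1 p.2 ∂μ = (∫⁻ z, μ (Iic z) ∂μ).toReal := by
    have hms : MeasurableSet {p : (ℝ × ℝ) × (ℝ × ℝ) | p.2 ≤ p.1} :=
      measurableSet_le measurable_snd measurable_fst
    have hmeas : Measurable fun z => μ (Iic z) := measurable_measure_prodMk_left hms
    rw [← integral_toReal hmeas.aemeasurable (ae_of_all _ fun z => measure_lt_top _ _)]
    refine integral_congr_ae ?_
    filter_upwards [measure_Iic_ae_eq hC.1 hμ, ae_mem_unitSquare hC.1 hμ] with z hz hzI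
    rw [hz, ENNReal.toReal_ofReal (hC.1.nonneg hzI.1 hzI.2)]
  have hF1 : ∫ p : ℝ × ℝ, C p.1 p.2 ∂μ ≤ (k + 1) * h + (k + 1) * k * c := by
    have h1 := ENNReal.toReal_mono (ENNReal.sum_ne_top.2 fun p _ => measure_ne_top _ _)
      (lintegral_measure_Iic_le_sum_maxAt ι hC hμ)
    rw [ENNReal.toReal_sum fun p _ => measure_ne_top _ _] at h1
    rw [hint]
    refine h1.trans_eq ?_
    rw [Finset.sum_congr rfl fun p _ => hQ (Sum.inl p.1) (Sum.inl p.2)]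
    simp only [Sum.inl.injEq]
    rw [sum_ite_eq_card]
    simp [ι]
  have hF2 : (2 * k + 2) * h + (2 * k + 2) * (2 * k + 1) * c ≤ 1 := by
    have h1 := ENNReal.toReal_mono ENNReal.one_ne_top (sum_measure_maxAt_le (ι := ι ⊕ ι) μ
      (measure_fst_eq_zero hC.1 hμ) (measure_snd_eq_zero hC.1 hμ))
    rw [ENNReal.toReal_sum fun p _ => measure_ne_top _ _,
      Finset.sum_congr rfl fun p _ => hQ p.1 p.2, sum_ite_eq_card] at h1
    simp [ι] at h1
    linarith
  have hk : (0 : ℝ) ≤ k := k.cast_nonneg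
  obtain ⟨hlam0, hlam1⟩ := hlam
  have hF3 : h ≤ (2 + 2 * k * lam) / (2 * k + 2) ^ 2 := by
    have h1 := lintegral_measure_Iic_pow_le hC hlam1 hU hμ (K := 2 * k + 1) (by omega)
    have h2 := measure_maxAt_self_eq_lintegral (ι := ι ⊕ ι) μ (Sum.inl 0)
    have hcard : Fintype.card (ι ⊕ ι) - 1 = 2 * k + 1 := by simp [ι]; omega
    rw [hcard] at h2
    refine ENNReal.toReal_le_of_le_ofReal (by positivity)
      ((h2.trans_le h1).trans (ENNReal.ofReal_le_ofReal ?_))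
    push_cast
    have hpos : (0 : ℝ) < 2 * k + 1 + (2 - lam) := by linarith
    calc 1 - 2 * (2 * (k : ℝ) + 1) / (2 * k + 1 + 1) + (2 * k + 1) / (2 * k + 1 + (2 - lam))
        = (2 + 2 * k * lam) / ((2 * k + 2) * (2 * k + 1 + (2 - lam))) := by
          have : (2 * k + 1 + 1 : ℝ) ≠ 0 := by positivity
          field_simp
          ring
      _ ≤ _ := by
          rw [sq]
          have : 2 * (k : ℝ) + 2 ≤ 2 * k + 1 + (2 - lam) := by linarith
          gcongr
  rw [le_div_iff₀ (by positivity)] at hF3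
  have hmain : (2 * k + 1) * (4 * (∫ p : ℝ × ℝ, C p.1 p.2 ∂μ) - 1) ≤ 1 + 2 * k * lam := by
    nlinarith [mul_le_mul_of_nonneg_left hF1 (by positivity : (0 : ℝ) ≤ 4 * (2 * k + 1)),
      mul_le_mul_of_nonneg_left hF2 (by positivity : (0 : ℝ) ≤ 2 * k)]
  calc _ ≤ (1 + 2 * k * lam) / (2 * k + 1) := by
        rw [le_div_iff₀ (by positivity)]
        linarith
    _ ≤ (lam * (2 * k + 1) + 1) / (2 * k + 1) := by
        refine div_le_div_of_nonneg_right ?_ (by positivity)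
        linarith
    _ = lam + 1 / (2 * k + 1) := by
        field_simp
    _ ≤ _ := by
        gcongr
        linarith

end Copula

theorem stmt_10 (C : ℝ → ℝ → ℝ) (lam : ℝ) (hlam : lam ∈ Set.Icc (0:ℝ) 1)
    (hC : IsExtremeValueCopula C) (hU : HasUpperTailDep C lam)
    (μ : Measure (ℝ × ℝ)) [IsProbabilityMeasure μ]
    (hμ : ∀ u v : ℝ, u ∈ Set.Icc (0:ℝ) 1 → v ∈ Set.Icc (0:ℝ) 1 →
      μ (Set.Icc 0 u ×ˢ Set.Icc 0 v) = ENNReal.ofReal (C u v)) :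
    4 * (∫ p : ℝ × ℝ, C p.1 p.2 ∂μ) - 1 ≤ lam := by
  have hlim : Tendsto (fun k : ℕ => lam + 1 / ((k : ℝ) + 1)) atTop (nhds (lam + 0)) :=
    tendsto_one_div_add_atTop_nhds_zero_nat.const_add lam
  rw [add_zero] at hlim
  exact ge_of_tendsto' hlim (four_mul_integral_sub_one_le_add hC hlam hU hμ)
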